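/- Fix an integer t ≥ 2. For every integer r ≥ 1 and all (q,u) in the domain of analyticity |q u^{t−1}| < 1, |q| < 1, the coefficients of b(q,u,1,1) as a power series in u satisfy q^r·(1 − Σ_{j=1}^{⌈r/t⌉−1} [u^{jt}] b(q,u,1,1)) = [u^{rt}] b(q,u,1,1). In particular, setting p_r = [u^{rt}] b(q_0,u,1,1) where q_0 is the dominant zero of 1 − b(q,1,1,1), the vector (p_r)_{r≥1} is a right eigenvector of the infinite matrix M_∞(q_0) = (q_0^r·[r ≤ ts])_{r,s≥1} with eigenvalue 1, i.e., Σ_{s ≥ ⌈r/t⌉} q_0^r p_s = p_r for all r ≥ 1. -/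

import Mathlib

open scoped BigOperators
open Filter MeasureTheory

noncomputable section

/-- `hp t j = 1 + t + ⋯ + t^(j-1) = (t^j - 1)/(t-1)`. -/
def hp (t j : ℕ) : ℕ := ∑ i ∈ Finset.range j, t ^ i

/-- The series `b(q,u,v,w)`
`b = Σ_{j≥1} v q^{h_j} u^{t^j} w^j/(1−q^{h_j} u^{t^j}) ∏_{i=1}^{j−1} (1−v−q^{h_i}u^{t^i})/(1−q^{h_i}u^{t^i})`. -/
def bGF (t : ℕ) (q u v w : ℂ) : ℂ :=
  ∑' j : ℕ,
    v * q ^ hp t (j + 1) * u ^ t ^ (j + 1) * w ^ (j + 1) /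
        (1 - q ^ hp t (j + 1) * u ^ t ^ (j + 1)) *
      ∏ i ∈ Finset.Icc 1 j,
        (1 - v - q ^ hp t i * u ^ t ^ i) / (1 - q ^ hp t i * u ^ t ^ i)

/-- The series `a(q,u,v,w)` (for canonical forests with `r` roots)
`a = Σ_{j≥0} v q^{r h_j} u^{r t^j} w^j ∏_{i=1}^{j} (1−v−q^{h_i}u^{t^i})/(1−q^{h_i}u^{t^i})`. -/
def aGF (t r : ℕ) (q u v w : ℂ) : ℂ :=
  ∑' j : ℕ,
    v * q ^ (r * hp t j) * u ^ (r * t ^ j) * w ^ j *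
      ∏ i ∈ Finset.Icc 1 j,
        (1 - v - q ^ hp t i * u ^ t ^ i) / (1 - q ^ hp t i * u ^ t ^ i)

/-- A canonical `t`-ary forest with `r` (ordered) roots, encoded by its sequence of
numbers of internal vertices on each level (a canonical forest is uniquely determined
by this sequence: on each level the leaves come first, since outdegrees read from left
to right are non-decreasing).  The number `c_0` of internal vertices on level `0` is at
most `r`, each level's internal-vertex count satisfies `1 ≤ c_{k+1} ≤ t·c_k`, and the
list stops at the last level containing internal vertices. -/
structure CanonicalForest (t r : ℕ) where
  levels : List ℕ
  pos : ∀ c ∈ levels, 0 < c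
  head_le : ∀ c ∈ levels.head?, c ≤ r
  chain : levels.Chain' fun a b => b ≤ t * a

namespace CanonicalForest

variable {t r : ℕ} (T : CanonicalForest t r)

/-- the number `n(T)` of internal vertices -/
def size : ℕ := T.levels.sum

/-- the height `h(T)`: the maximal distance of a leaf from the root level -/
def height : ℕ := T.levels.length

/-- the number of internal vertices at depth `k` -/
def internAt (k : ℕ) : ℕ := T.levels.getD k 0

/-- the number of vertices at depth `k` -/
def vertsAt (k : ℕ) : ℕ := if k = 0 then r else t * T.internAt (k - 1)

/-- the number of leaves at depth `k` -/
def leavesAt (k : ℕ) : ℕ := T.vertsAt k - T.internAt k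

/-- the number `m(T)` of leaves at maximal depth -/
def lastLeaves : ℕ := T.vertsAt T.height

/-- the number `d(T)` of distinct depths at which leaves occur -/
def distinctDepths : ℕ :=
  ((Finset.range (T.height + 1)).filter fun k => 0 < T.leavesAt k).card

/-- the (leaf-)width `w(T)`: the maximal number of leaves on one level -/
def width : ℕ := (Finset.range (T.height + 1)).sup fun k => T.leavesAt k

/-- the total path length `ℓ(T)`: the sum of the depths of all vertices -/
def pathLength : ℕ := ∑ k ∈ Finset.range (T.height + 1), k * T.vertsAt k

end CanonicalForest

/-- the number of canonical `t`-ary forests with `r` roots and `n` internal vertices -/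
def forestCount (t r n : ℕ) : ℕ := Nat.card {T : CanonicalForest t r // T.size = n}

/-- the probability of an event under the uniform distribution on canonical `t`-ary
forests with `r` roots and `n` internal vertices -/
def forestProb (t r n : ℕ) (s : Set (CanonicalForest t r)) : ℝ :=
  (Nat.card {T : CanonicalForest t r // T.size = n ∧ T ∈ s} : ℝ) / forestCount t r n

/-- the expectation of a random variable under the uniform distribution on canonical
`t`-ary forests with `r` roots and `n` internal vertices -/
def forestExp (t r n : ℕ) (f : CanonicalForest t r → ℝ) : ℝ :=
  (∑ᶠ T : {T : CanonicalForest t r // T.size = n}, f T.1) / forestCount t r n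

/-- the variance of a random variable under the uniform distribution on canonical
`t`-ary forests with `r` roots and `n` internal vertices -/
def forestVar (t r n : ℕ) (f : CanonicalForest t r → ℝ) : ℝ :=
  forestExp t r n (fun T => f T ^ 2) - forestExp t r n f ^ 2

/-- the distribution function of the standard normal distribution -/
def stdGaussCDF (x : ℝ) : ℝ :=
  (Real.sqrt (2 * Real.pi))⁻¹ * ∫ u in Set.Iic x, Real.exp (-u ^ 2 / 2)

/-- the density of the standard normal distribution -/
def stdGaussPDF (x : ℝ) : ℝ :=
  (Real.sqrt (2 * Real.pi))⁻¹ * Real.exp (-x ^ 2 / 2)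


/-- the power-series coefficient `[u^m] b(q,u,1,1)` of `u ↦ b(q,u,1,1)` at `u = 0` -/
def bCoeff (t : ℕ) (q : ℂ) (m : ℕ) : ℂ :=
  iteratedDeriv m (fun u : ℂ => bGF t q u 1 1) 0 / m.factorial

/-! ### Helper lemmas -/

lemma hp_succ' (t j : ℕ) : hp t (j + 1) = hp t j + t ^ j := by
  simp [hp, Finset.sum_range_succ]

/-- The `j`-th monomial `q^{h_j} u^{t^j}`. -/
def xm (t : ℕ) (q u : ℂ) (j : ℕ) : ℂ := q ^ hp t j * u ^ t ^ j

lemma xm_succ (t : ℕ) (q u : ℂ) (j : ℕ) : xm t q u (j + 1) = xm t q (q * u ^ t) j := by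
  simp only [xm, hp_succ', mul_pow, pow_add, ← pow_mul, pow_succ]
  rw [mul_comm t (t ^ j)]; ring

lemma xm_zero (t : ℕ) (q u : ℂ) : xm t q u 0 = u := by simp [xm, hp]

/-- The summand of `b(q,u,1,1)`. -/
def bT (t : ℕ) (q u : ℂ) (j : ℕ) : ℂ :=
  xm t q u (j + 1) / (1 - xm t q u (j + 1)) *
    ∏ i ∈ Finset.range j, (-(xm t q u (i + 1)) / (1 - xm t q u (i + 1)))

lemma bGF_eq (t : ℕ) (q u : ℂ) : bGF t q u 1 1 = ∑' j, bT t q u j := by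
  unfold bGF bT xm
  refine tsum_congr fun j => ?_
  have h : Finset.Icc 1 j = Finset.Ico 1 (j + 1) := by ext; simp [Nat.lt_succ_iff]
  rw [h, Finset.prod_Ico_eq_prod_range]
  simp [add_comm 1]

lemma bT_zero (t : ℕ) (q u : ℂ) :
    bT t q u 0 = (q * u ^ t) / (1 - q * u ^ t) := by
  simp [bT, xm_succ, xm_zero]

lemma bT_succ (t : ℕ) (q u : ℂ) (j : ℕ) :
    bT t q u (j + 1) = -((q * u ^ t) / (1 - q * u ^ t)) * bT t q (q * u ^ t) j := by
  unfold bT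
  rw [Finset.prod_range_succ']
  simp only [xm_succ t q u, xm_zero]
  ring

lemma xm_bound {t : ℕ} (ht : 2 ≤ t) {q u : ℂ} (hq : ‖q‖ < 1) {ρ : ℝ}
    (hu : ‖q * u ^ t‖ ≤ ρ) (j : ℕ) : ‖xm t q u (j + 1)‖ ≤ ρ ^ t ^ j := by
  rw [xm_succ, xm, norm_mul, norm_pow, norm_pow]
  have h1 : ‖q‖ ^ hp t j ≤ 1 := pow_le_one₀ (norm_nonneg _) hq.le
  have h2 : ‖q * u ^ t‖ ^ t ^ j ≤ ρ ^ t ^ j := pow_le_pow_left₀ (norm_nonneg _) hu _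
  calc _ ≤ 1 * ‖q * u ^ t‖ ^ t ^ j := by gcongr
    _ ≤ _ := by rw [one_mul]; exact h2

lemma frac_bound {t : ℕ} (ht : 2 ≤ t) {q u : ℂ} (hq : ‖q‖ < 1) {ρ : ℝ} (h0 : 0 < ρ) (h1 : ρ < 1)
    (hu : ‖q * u ^ t‖ ≤ ρ) (j : ℕ) :
    1 - xm t q u (j + 1) ≠ 0 ∧
    ‖xm t q u (j + 1) / (1 - xm t q u (j + 1))‖ ≤ ρ ^ t ^ j / (1 - ρ) := by
  have hb := xm_bound ht hq hu j
  have hb' : ‖xm t q u (j + 1)‖ ≤ ρ := hb.trans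
    (pow_le_of_le_one h0.le h1.le (by positivity))
  have h2 : 1 - ρ ≤ ‖1 - xm t q u (j + 1)‖ := by
    have := norm_sub_norm_le (1 : ℂ) (xm t q u (j + 1))
    rw [norm_one] at this
    linarith
  have h3 : 0 < 1 - ρ := by linarith
  refine ⟨fun h => ?_, ?_⟩
  · rw [h, norm_zero] at h2; linarith
  · rw [norm_div]
    gcongr

/-- dominating sequence -/
def domS (t : ℕ) (ρ : ℝ) (j : ℕ) : ℝ := ∏ i ∈ Finset.range (j + 1), ρ ^ t ^ i / (1 - ρ)

lemma bT_bound {t : ℕ} (ht : 2 ≤ t) {q u : ℂ} (hq : ‖q‖ < 1) {ρ : ℝ} (h0 : 0 < ρ) (h1 : ρ < 1)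
    (hu : ‖q * u ^ t‖ ≤ ρ) (j : ℕ) : ‖bT t q u j‖ ≤ domS t ρ j := by
  have h3 : 0 < 1 - ρ := by linarith
  rw [bT, domS, Finset.prod_range_succ, mul_comm, norm_mul, norm_prod]
  refine mul_le_mul (Finset.prod_le_prod (fun _ _ => norm_nonneg _) fun i _ => ?_)
    (frac_bound ht hq h0 h1 hu j).2 (norm_nonneg _)
    (Finset.prod_nonneg fun _ _ => by positivity)
  rw [neg_div, norm_neg]
  exact (frac_bound ht hq h0 h1 hu i).2

lemma domS_summable {t : ℕ} (ht : 2 ≤ t) {ρ : ℝ} (h0 : 0 < ρ) (h1 : ρ < 1) :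
    Summable (domS t ρ) := by
  have h3 : 0 < 1 - ρ := by linarith
  have hpos : ∀ j, 0 < domS t ρ j := fun j => Finset.prod_pos fun _ _ => by positivity
  refine summable_of_ratio_test_tendsto_lt_one (l := 0) one_pos
    (Eventually.of_forall fun j => (hpos j).ne') ?_
  have : (fun n => ‖domS t ρ (n + 1)‖ / ‖domS t ρ n‖) = fun n => ρ ^ t ^ (n + 1) / (1 - ρ) := by
    funext n
    rw [Real.norm_of_nonneg (hpos _).le, Real.norm_of_nonneg (hpos _).le]
    rw [div_eq_iff (hpos n).ne', mul_comm]
    simp only [domS]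
    rw [Finset.prod_range_succ _ (n + 1)]
  rw [this]
  have h4 : Tendsto (fun n : ℕ => t ^ (n + 1)) atTop atTop :=
    (tendsto_pow_atTop_atTop_of_one_lt (by omega)).comp (tendsto_add_atTop_nat 1)
  simpa using ((tendsto_pow_atTop_nhds_zero_of_lt_one h0.le h1).comp h4).div_const (1 - ρ)

/-- good radius -/
lemma exists_radius (t : ℕ) {q : ℂ} (hq : ‖q‖ < 1) :
    ∃ R : ℝ, 1 < R ∧ ∃ ρ : ℝ, 0 < ρ ∧ ρ < 1 ∧ ∀ u : ℂ, ‖u‖ < R → ‖q * u ^ t‖ ≤ ρ := by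
  have hc : Tendsto (fun R : ℝ => ‖q‖ * R ^ t) (nhdsWithin 1 (Set.Ioi 1)) (nhds (‖q‖ * 1 ^ t)) :=
    (Continuous.tendsto (by fun_prop) 1).mono_left nhdsWithin_le_nhds
  have h1 : ∀ᶠ R : ℝ in nhdsWithin 1 (Set.Ioi 1), ‖q‖ * R ^ t < 1 :=
    hc.eventually (gt_mem_nhds (by simpa using hq))
  obtain ⟨R, hR, hR1⟩ := (h1.and self_mem_nhdsWithin).exists
  have hR1 : 1 < R := hR1
  refine ⟨R, hR1, max (‖q‖ * R ^ t) (1 / 2), by positivity, max_lt hR (by norm_num),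
    fun u hu => le_max_of_le_left ?_⟩
  rw [norm_mul, norm_pow]
  gcongr

lemma bGF_diff {t : ℕ} (ht : 2 ≤ t) {q : ℂ} (hq : ‖q‖ < 1) {R ρ : ℝ} (h0 : 0 < ρ) (h1 : ρ < 1)
    (hR : ∀ u : ℂ, ‖u‖ < R → ‖q * u ^ t‖ ≤ ρ) :
    DifferentiableOn ℂ (fun u => bGF t q u 1 1) (Metric.ball 0 R) := by
  simp only [bGF_eq]
  refine Complex.differentiableOn_tsum_of_summable_norm (domS_summable ht h0 h1) (fun j => ?_)
    Metric.isOpen_ball (fun j u hu => bT_bound ht hq h0 h1 (hR u (by simpa using hu)) j)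
  have hne : ∀ i, ∀ u ∈ Metric.ball (0 : ℂ) R, 1 - xm t q u (i + 1) ≠ 0 := fun i u hu =>
    (frac_bound ht hq h0 h1 (hR u (by simpa using hu)) i).1
  have hx : ∀ i, DifferentiableOn ℂ (fun u => xm t q u (i + 1)) (Metric.ball 0 R) := fun i => by
    unfold xm; fun_prop
  unfold bT
  refine DifferentiableOn.mul ((hx j).div ((differentiableOn_const 1).sub (hx j)) (hne j)) ?_
  refine DifferentiableOn.fun_finsetProd fun i _ => ?_
  exact (hx i).neg.div ((differentiableOn_const 1).sub (hx i)) (hne i)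

lemma bGF_func {t : ℕ} (ht : 2 ≤ t) {q : ℂ} (hq : ‖q‖ < 1) {u : ℂ} {ρ : ℝ} (h0 : 0 < ρ)
    (h1 : ρ < 1) (hu : ‖q * u ^ t‖ ≤ ρ) :
    bGF t q u 1 1 = (q * u ^ t) / (1 - q * u ^ t) * (1 - bGF t q (q * u ^ t) 1 1) := by
  rw [bGF_eq, bGF_eq]
  have hs : Summable (bT t q u) :=
    Summable.of_norm_bounded (domS_summable ht h0 h1) (bT_bound ht hq h0 h1 hu)
  rw [hs.tsum_eq_zero_add, bT_zero]
  simp only [bT_succ, tsum_mul_left]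
  ring

lemma hs_congr {f g : ℕ → ℂ} {S : ℂ} (h : HasSum f S) (e : ∀ n, g n = f n) : HasSum g S := by
  rwa [show g = f from funext e]

lemma coeff_unique {a : ℕ → ℂ} {r : ℝ} (hr : 0 < r)
    (h : ∀ z : ℂ, ‖z‖ < r → HasSum (fun n => a n * z ^ n) 0) (n : ℕ) : a n = 0 := by
  have hp : HasFPowerSeriesAt (fun _ : ℂ => (0 : ℂ)) (FormalMultilinearSeries.ofScalars ℂ a) 0 := by
    rw [hasFPowerSeriesAt_iff]
    filter_upwards [Metric.ball_mem_nhds (0 : ℂ) hr] with z hz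
    simpa [FormalMultilinearSeries.coeff_ofScalars, mul_comm] using h z (by simpa using hz)
  have := hp.eq_zero
  have h2 : (FormalMultilinearSeries.ofScalars ℂ a).coeff n = 0 := by
    rw [this]; rfl
  rwa [FormalMultilinearSeries.coeff_ofScalars] at h2

lemma taylor_hasSum {f : ℂ → ℂ} {R : ℝ} (hf : DifferentiableOn ℂ f (Metric.ball 0 R)) {z : ℂ}
    (hz : ‖z‖ < R) : HasSum (fun n => iteratedDeriv n f 0 / n.factorial * z ^ n) (f z) := by
  have := Complex.hasSum_taylorSeries_on_ball hf (z := z) (by simpa using hz)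
  refine hs_congr (this) fun n => ?_
  simp only [sub_zero, smul_eq_mul]
  ring

/-- shift -/
def shf (c : ℕ → ℂ) : ℕ → ℂ
  | 0 => 0
  | n + 1 => c n

lemma shf_hasSum {c : ℕ → ℂ} {x S : ℂ} (h : HasSum (fun n => c n * x ^ n) S) :
    HasSum (fun n => shf c n * x ^ n) (x * S) := by
  rw [← hasSum_nat_add_iff' 1]
  simp only [shf, Finset.sum_range_one, zero_mul, sub_zero]
  refine hs_congr (h.mul_left x) fun n => ?_
  ring

lemma bCoeff_main {t : ℕ} (ht : 2 ≤ t) {q : ℂ} (hq : ‖q‖ < 1) :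
    ∃ g : ℕ → ℂ, g 0 = 0 ∧ (∀ n, g (n + 1) = 1 - ∑ k ∈ Finset.range (n + 1), bCoeff t q k) ∧
      (∀ n, bCoeff t q n = if t ∣ n then q ^ (n / t) * g (n / t) else 0) := by
  obtain ⟨R, hR1, ρ, h0, h1, hR⟩ := exists_radius t hq
  have hB := bGF_diff ht hq h0 h1 hR
  set B : ℂ → ℂ := fun u => bGF t q u 1 1 with hBdef
  set G : ℂ → ℂ := fun x => x / (1 - x) * (1 - B x) with hG
  have hne : ∀ x : ℂ, ‖x‖ < 1 → 1 - x ≠ 0 := fun x hx h => by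
    rw [← sub_eq_zero.mp h] at hx; simp at hx
  have hGd : DifferentiableOn ℂ G (Metric.ball 0 1) := by
    refine DifferentiableOn.mul (differentiableOn_id.div
      ((differentiableOn_const 1).sub differentiableOn_id) fun x hx => hne x (by simpa using hx)) ?_
    exact (differentiableOn_const 1).sub (hB.mono (Metric.ball_subset_ball hR1.le))
  set g : ℕ → ℂ := fun n => iteratedDeriv n G 0 / n.factorial with hg
  have hGs : ∀ x : ℂ, ‖x‖ < 1 → HasSum (fun n => g n * x ^ n) (G x) := fun x hx =>
    taylor_hasSum hGd hx
  have hBs : ∀ x : ℂ, ‖x‖ < R → HasSum (fun n => bCoeff t q n * x ^ n) (B x) := fun x hx =>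
    taylor_hasSum hB hx
  have hrel : ∀ n, g n - shf g n - (if n = 1 then 1 else 0) + shf (bCoeff t q) n = 0 := by
    refine coeff_unique one_pos fun x hx => ?_
    have e1 := hGs x hx
    have e2 := shf_hasSum e1
    have e3 := shf_hasSum (hBs x (hx.trans hR1))
    have e4 : HasSum (fun n => (if n = 1 then (1 : ℂ) else 0) * x ^ n) x := by
      refine hs_congr (hasSum_ite_eq (1 : ℕ) x) fun n => ?_
      split_ifs with h <;> simp [h]
    have e5 := ((e1.sub e2).sub e4).add e3
    have : G x - x * G x - x + x * B x = 0 := by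
      have := hne x hx
      simp only [hG]
      field_simp
      ring
    rw [this] at e5
    refine hs_congr (e5) fun n => ?_
    ring
  have hg0 : g 0 = 0 := by simpa [shf] using hrel 0
  refine ⟨g, hg0, fun n => ?_, fun n => ?_⟩
  · induction n with
    | zero =>
      have := hrel 1
      simp [shf, hg0] at this
      simp
      linear_combination this
    | succ n ih =>
      have := hrel (n + 2)
      simp [shf] at this
      rw [Finset.sum_range_succ]
      linear_combination this + ih
  · rw [← sub_eq_zero]
    revert n
    refine coeff_unique (r := 1) one_pos fun u hu => ?_
    have hu' := hR u (hu.trans hR1)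
    have e1 := hBs u (hu.trans hR1)
    have e2 := hGs (q * u ^ t) (hu'.trans_lt h1)
    have hBG : B u = G (q * u ^ t) := bGF_func ht hq h0 h1 hu'
    have hinj : Function.Injective (fun n : ℕ => n * t) := fun a b h =>
      Nat.eq_of_mul_eq_mul_right (by omega) h
    have e3 : HasSum (fun n => (if t ∣ n then q ^ (n / t) * g (n / t) else 0) * u ^ n)
        (G (q * u ^ t)) := by
      rw [← hinj.hasSum_iff]
      · refine hs_congr (e2) fun n => ?_
        have : 0 < t := by omega
        simp [Nat.mul_div_cancel _ this, mul_pow, ← pow_mul]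
        rw [mul_comm t n]; ring
      · intro n hn
        rw [if_neg, zero_mul]
        rintro ⟨k, rfl⟩
        exact hn ⟨k, mul_comm _ _⟩
    have e4 := e1.sub e3
    rw [hBG, sub_self] at e4
    refine hs_congr (e4) fun n => ?_
    ring

lemma bCoeff_hasSum_one {t : ℕ} (ht : 2 ≤ t) {q : ℂ} (hq : ‖q‖ < 1) :
    HasSum (fun n => bCoeff t q n) (bGF t q 1 1 1) := by
  obtain ⟨R, hR1, ρ, h0, h1, hR⟩ := exists_radius t hq
  have := taylor_hasSum (bGF_diff ht hq h0 h1 hR) (z := 1) (by simpa using hR1)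
  simpa [bCoeff] using this

lemma bCoeff_rec {t : ℕ} (ht : 2 ≤ t) {q : ℂ} (hq : ‖q‖ < 1) (r : ℕ) (hr : 1 ≤ r) :
    q ^ r * (1 - ∑ j ∈ Finset.Ico 1 ((r + t - 1)/t), bCoeff t q (j * t))
        = bCoeff t q (r * t) := by
  obtain ⟨g, hg0, hg1, hb⟩ := bCoeff_main ht hq
  have ht0 : 0 < t := by omega
  obtain ⟨n, rfl⟩ : ∃ n, r = n + 1 := ⟨r - 1, by omega⟩
  rw [hb ((n + 1) * t), if_pos (Dvd.intro_left _ rfl), Nat.mul_div_cancel _ ht0, hg1]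
  congr 2
  have hc0 : bCoeff t q 0 = 0 := by rw [hb]; simp [hg0]
  have hinj : Function.Injective (fun n : ℕ => n * t) := fun a b h =>
      Nat.eq_of_mul_eq_mul_right ht0 h
  rw [← Finset.sum_image (s := Finset.Ico 1 ((n + 1 + t - 1)/t)) (g := fun j => j * t)
    (f := bCoeff t q) hinj.injOn]
  have hceil : (n + 1 + t - 1) / t = n / t + 1 := by
    rw [show n + 1 + t - 1 = n + t by omega, Nat.add_div_right _ ht0]
  rw [hceil]
  refine Finset.sum_subset ?_ ?_
  · intro m hm
    simp only [Finset.mem_image, Finset.mem_Ico] at hm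
    obtain ⟨j, ⟨_, hj⟩, rfl⟩ := hm
    have := (Nat.le_div_iff_mul_le ht0).mp (Nat.lt_succ_iff.mp hj)
    simp; omega
  · intro m hm hm'
    by_cases hd : t ∣ m
    · obtain ⟨k, rfl⟩ := hd
      rcases Nat.eq_zero_or_pos k with rfl | hk
      · simpa using hc0
      · exfalso
        apply hm'
        simp only [Finset.mem_image, Finset.mem_Ico]
        simp only [Finset.mem_range] at hm
        refine ⟨k, ⟨hk, Nat.lt_succ_iff.mpr ((Nat.le_div_iff_mul_le ht0).mpr ?_)⟩, mul_comm _ _⟩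
        rw [mul_comm]; omega
    · rw [hb, if_neg hd]

/-- For all `r ≥ 1` and `|q| < 1`:
`q^r·(1 − Σ_{j=1}^{⌈r/t⌉−1} [u^{jt}]b(q,u,1,1)) = [u^{rt}]b(q,u,1,1)`; in particular,
with `p_r = [u^{rt}]b(q₀,u,1,1)` at the dominant root `q₀` of `1 − b(q,1,1,1)`, one has
`Σ_{s ≥ ⌈r/t⌉} q₀^r p_s = p_r` for all `r ≥ 1`, i.e. `(p_r)_{r≥1}` is a right
eigenvector of `M_∞(q₀)` with eigenvalue `1`.  (Here `⌈r/t⌉ = (r + t − 1)/t` in `ℕ`.) -/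
theorem eigenvector_of_infinite_transfer_matrix (t : ℕ) (ht : 2 ≤ t) :
    (∀ r : ℕ, 1 ≤ r → ∀ q : ℂ, ‖q‖ < 1 →
      q ^ r * (1 - ∑ j ∈ Finset.Ico 1 ((r + t - 1)/t), bCoeff t q (j * t))
        = bCoeff t q (r * t)) ∧
    (∀ q₀ : ℝ, 0 < q₀ → q₀ < 1 - 0.72 / t → bGF t (q₀ : ℂ) 1 1 1 = 1 →
      ∀ r : ℕ, 1 ≤ r →
        HasSum
          (fun s : ℕ => (q₀ : ℂ) ^ r * bCoeff t (q₀ : ℂ) ((s + (r + t - 1)/t) * t))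
          (bCoeff t (q₀ : ℂ) (r * t))) := by
  refine ⟨fun r hr q hq => bCoeff_rec ht hq r hr, fun q₀ h0 h1 hb r hr => ?_⟩
  have ht0 : 0 < t := by omega
  have hq : ‖(q₀ : ℂ)‖ < 1 := by
    rw [Complex.norm_real, Real.norm_of_nonneg h0.le]
    have : (0 : ℝ) < 0.72 / t := by positivity
    linarith
  obtain ⟨g, hg0, hg1, hbc⟩ := bCoeff_main ht hq
  have hs := bCoeff_hasSum_one ht hq
  rw [hb] at hs
  have hinj : Function.Injective (fun n : ℕ => n * t) := fun a b h =>
      Nat.eq_of_mul_eq_mul_right ht0 h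
  have hs2 : HasSum (fun n => bCoeff t (q₀ : ℂ) (n * t)) 1 := by
    refine (hinj.hasSum_iff (f := fun n => bCoeff t (q₀ : ℂ) n) ?_).mpr hs
    intro n hn
    rw [hbc, if_neg]
    rintro ⟨k, rfl⟩
    exact hn ⟨k, mul_comm _ _⟩
  have hs3 := ((hasSum_nat_add_iff' ((r + t - 1) / t)).mpr hs2).mul_left ((q₀ : ℂ) ^ r)
  have hK : 0 < (r + t - 1) / t := Nat.div_pos (by omega) ht0
  have hc0 : bCoeff t (q₀ : ℂ) 0 = 0 := by rw [hbc]; simp [hg0]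
  rw [Finset.range_eq_Ico, Finset.sum_eq_sum_Ico_succ_bot hK, zero_mul, hc0, zero_add,
    zero_add, bCoeff_rec ht hq r hr] at hs3
  exact hs3

end
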